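/- Let α, ν ∈ ℝ and let Q be an admissible quantization of V_α of type (i)′ with parameter ν. Then (ℓ² + 2αℓ)sin θ and (ℓ² + 2αℓ)cos θ belong to V_α, and as linear operators on D: Q((ℓ² + 2αℓ)sin θ) = Q(sin θ)Q(ℓ)² + (2α·Q(sin θ) − i·Q(cos θ))Q(ℓ) + (1/2)Q(sin θ) − iα·Q(cos θ), and Q((ℓ² + 2αℓ)cos θ) = Q(cos θ)Q(ℓ)² + (2α·Q(cos θ) + i·Q(sin θ))Q(ℓ) + (1/2)Q(cos θ) + iα·Q(sin θ). -/

import Mathlib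

noncomputable section

open Complex

/-- Partial derivative in the first (angle) variable. -/
def pdTheta (f : ℝ × ℝ → ℝ) : ℝ × ℝ → ℝ := fun p => deriv (fun t => f (t, p.2)) p.1

/-- Partial derivative in the second (momentum) variable. -/
def pdEll (f : ℝ × ℝ → ℝ) : ℝ × ℝ → ℝ := fun p => deriv (fun l => f (p.1, l)) p.2

/-- Poisson bracket `{f,g} = f_ℓ g_θ − f_θ g_ℓ`. -/
def pb (f g : ℝ × ℝ → ℝ) : ℝ × ℝ → ℝ :=
  fun p => pdEll f p * pdTheta g p - pdTheta f p * pdEll g p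

/-- Spanning set for the polynomial algebra `P`. -/
def PGens : Set (ℝ × ℝ → ℝ) :=
  {h | ∃ r m : ℕ, h = (fun p : ℝ × ℝ => p.2 ^ r * Real.sin (m * p.1)) ∨
       h = (fun p : ℝ × ℝ => p.2 ^ r * Real.cos (m * p.1))}

/-- The polynomial algebra `P`. -/
def P : Submodule ℝ (ℝ × ℝ → ℝ) := Submodule.span ℝ PGens

def fone : ℝ × ℝ → ℝ := fun _ => 1
def fell : ℝ × ℝ → ℝ := fun p => p.2
def fsin : ℝ × ℝ → ℝ := fun p => Real.sin p.1
def fcos : ℝ × ℝ → ℝ := fun p => Real.cos p.1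

lemma fone_mem_P : fone ∈ P :=
  Submodule.subset_span ⟨0, 0, Or.inr (by funext p; simp [fone])⟩

lemma fell_mem_P : fell ∈ P :=
  Submodule.subset_span ⟨1, 0, Or.inr (by funext p; simp [fell])⟩

lemma fsin_mem_P : fsin ∈ P :=
  Submodule.subset_span ⟨0, 1, Or.inl (by funext p; simp [fsin])⟩

lemma fcos_mem_P : fcos ∈ P :=
  Submodule.subset_span ⟨0, 1, Or.inr (by funext p; simp [fcos])⟩

/-- The domain `D = C^∞(S¹,ℂ)`: smooth `2π`-periodic functions. -/
def Dom : Submodule ℂ (ℝ → ℂ) where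
  carrier := {ψ | ContDiff ℝ (⊤ : ℕ∞) ψ ∧ ∀ t, ψ (t + 2 * Real.pi) = ψ t}
  add_mem' := by
    intro a b ha hb
    exact ⟨ha.1.add hb.1, fun t => by simp [Pi.add_apply, ha.2 t, hb.2 t]⟩
  zero_mem' := ⟨contDiff_const, fun t => rfl⟩
  smul_mem' := by
    intro c a ha
    exact ⟨ha.1.const_smul c, fun t => by simp [Pi.smul_apply, ha.2 t]⟩

/-- The `L²` inner product on `D`. -/
def ip (φ ψ : ℝ → ℂ) : ℂ := ∫ t in (0:ℝ)..(2 * Real.pi), (starRingEnd ℂ) (φ t) * ψ t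

/-- Symmetric operator on `D`. -/
def SymmetricOp (A : Dom →ₗ[ℂ] Dom) : Prop :=
  ∀ φ ψ : Dom, ip (A φ : ℝ → ℂ) (ψ : ℝ → ℂ) = ip (φ : ℝ → ℂ) (A ψ : ℝ → ℂ)

/-- An admissible quantization of type (i)′ with parameter ν of a Lie subalgebra
`O ⊆ P` containing the basic set. -/
structure IsQuant (O : Submodule ℝ (ℝ × ℝ → ℝ)) (ν : ℝ)
    (Q : O →ₗ[ℝ] (Dom →ₗ[ℂ] Dom)) : Prop where
  map_bracket : ∀ (f g : O) (h : pb f g ∈ O),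
    Q ⟨pb f g, h⟩ = Complex.I • (Q f ∘ₗ Q g - Q g ∘ₗ Q f)
  map_one : ∀ h : fone ∈ O, Q ⟨fone, h⟩ = LinearMap.id
  symm : ∀ f : O, SymmetricOp (Q f)
  map_ell : ∀ (h : fell ∈ O) (ψ : Dom) (t : ℝ),
    (Q ⟨fell, h⟩ ψ : ℝ → ℂ) t = -Complex.I * deriv (ψ : ℝ → ℂ) t + (ν : ℂ) * (ψ : ℝ → ℂ) t
  map_sin : ∀ (h : fsin ∈ O) (ψ : Dom) (t : ℝ),
    (Q ⟨fsin, h⟩ ψ : ℝ → ℂ) t = (Real.sin t : ℂ) * (ψ : ℝ → ℂ) t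
  map_cos : ∀ (h : fcos ∈ O) (ψ : Dom) (t : ℝ),
    (Q ⟨fcos, h⟩ ψ : ℝ → ℂ) t = (Real.cos t : ℂ) * (ψ : ℝ → ℂ) t

end
noncomputable section
/-- Partial θ-derivative of a complex-valued function. -/
def pdThetaC (f : ℝ × ℝ → ℂ) : ℝ × ℝ → ℂ := fun p => deriv (fun t => f (t, p.2)) p.1
/-- Partial ℓ-derivative of a complex-valued function. -/
def pdEllC (f : ℝ × ℝ → ℂ) : ℝ × ℝ → ℂ := fun p => deriv (fun l => f (p.1, l)) p.2
/-- Poisson bracket of complex-valued functions. -/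
def pbC (f g : ℝ × ℝ → ℂ) : ℝ × ℝ → ℂ :=
  fun p => pdEllC f p * pdThetaC g p - pdThetaC f p * pdEllC g p

/-- `e^r_m = ℓ^r e^{imθ}`. -/
def eC (r : ℕ) (m : ℤ) : ℝ × ℝ → ℂ :=
  fun p => (p.2 : ℂ) ^ r * Complex.exp (Complex.I * (m : ℂ) * (p.1 : ℂ))

/-- The complexification `P_ℂ` of `P`. -/
def PC : Submodule ℂ (ℝ × ℝ → ℂ) :=
  Submodule.span ℂ {h | ∃ (r : ℕ) (m : ℤ), h = eC r m}

/-- Closure under the Poisson bracket (complex case). -/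
def IsLieSubC (S : Submodule ℂ (ℝ × ℝ → ℂ)) : Prop :=
  ∀ f g : ℝ × ℝ → ℂ, f ∈ S → g ∈ S → pbC f g ∈ S

/-- The generators of `W_α`: `1, e^0_1, e^0_{−1}, e^1_0` and
`e^2_{2N+1} + 2α e^1_{2N+1}` for all `N ∈ ℤ`. -/
def WGens (α : ℝ) : Set (ℝ × ℝ → ℂ) :=
  {fun _ => 1, eC 0 1, eC 0 (-1), eC 1 0} ∪
    {h | ∃ N : ℤ, h = eC 2 (2 * N + 1) + (2 * α : ℂ) • eC 1 (2 * N + 1)}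

/-- `W_α`: the smallest complex Lie subalgebra of `P_ℂ` containing the generators. -/
def W (α : ℝ) : Submodule ℂ (ℝ × ℝ → ℂ) :=
  sInf {S | S ≤ PC ∧ WGens α ⊆ S ∧ IsLieSubC S}

/-- The complexification of a real-valued function. -/
def cplx (f : ℝ × ℝ → ℝ) : ℝ × ℝ → ℂ := fun p => (f p : ℂ)

/-- `V_α`: the real elements of `W_α`, a real Lie subalgebra of `P`. -/
def V (α : ℝ) : Submodule ℝ (ℝ × ℝ → ℝ) where
  carrier := {f | cplx f ∈ W α}
  add_mem' := by
    intro a b ha hb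
    simp only [Set.mem_setOf_eq] at *
    have h : cplx (a + b) = cplx a + cplx b := by
      funext p; simp [cplx]
    rw [h]; exact add_mem ha hb
  zero_mem' := by
    simp only [Set.mem_setOf_eq]
    have h : cplx (0 : ℝ × ℝ → ℝ) = 0 := by funext p; simp [cplx]
    rw [h]; exact zero_mem _
  smul_mem' := by
    intro c a ha
    simp only [Set.mem_setOf_eq] at *
    have h : cplx (c • a) = (c : ℂ) • cplx a := by
      funext p; simp [cplx]
    rw [h]; exact Submodule.smul_mem _ _ ha
end
noncomputable section
lemma mem_W_of_mem_WGens {α : ℝ} {f : ℝ × ℝ → ℂ} (hf : f ∈ WGens α) : f ∈ W α := by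
  rw [W, Submodule.mem_sInf]
  exact fun S hS => hS.2.1 hf

lemma fone_mem_V (α : ℝ) : fone ∈ V α := by
  show cplx fone ∈ W α
  have h : cplx fone = fun _ => (1 : ℂ) := by funext p; simp [cplx, fone]
  rw [h]
  exact mem_W_of_mem_WGens (Or.inl (by simp))

lemma fell_mem_V (α : ℝ) : fell ∈ V α := by
  show cplx fell ∈ W α
  have h : cplx fell = eC 1 0 := by
    funext p; simp [cplx, fell, eC]
  rw [h]
  exact mem_W_of_mem_WGens (Or.inl (by simp [WGens]))

lemma fsin_mem_V (α : ℝ) : fsin ∈ V α := by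
  show cplx fsin ∈ W α
  have h : cplx fsin = (Complex.I / 2) • eC 0 (-1) - (Complex.I / 2) • eC 0 1 := by
    funext p
    have h1 : Complex.I * (((1 : ℤ) : ℂ)) * (p.1 : ℂ) = (p.1 : ℂ) * Complex.I := by
      push_cast; ring
    have h2 : Complex.I * (((-1 : ℤ) : ℂ)) * (p.1 : ℂ) = -(p.1 : ℂ) * Complex.I := by
      push_cast; ring
    simp only [cplx, fsin, eC, Pi.sub_apply, Pi.smul_apply, smul_eq_mul, pow_zero, one_mul,
      h1, h2, Complex.ofReal_sin]
    rw [Complex.sin]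
    ring
  rw [h]
  exact sub_mem
    (Submodule.smul_mem _ _ (mem_W_of_mem_WGens (Or.inl (by simp [WGens]))))
    (Submodule.smul_mem _ _ (mem_W_of_mem_WGens (Or.inl (by simp [WGens]))))

lemma fcos_mem_V (α : ℝ) : fcos ∈ V α := by
  show cplx fcos ∈ W α
  have h : cplx fcos = ((1 : ℂ) / 2) • eC 0 1 + ((1 : ℂ) / 2) • eC 0 (-1) := by
    funext p
    have h1 : Complex.I * (((1 : ℤ) : ℂ)) * (p.1 : ℂ) = (p.1 : ℂ) * Complex.I := by
      push_cast; ring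
    have h2 : Complex.I * (((-1 : ℤ) : ℂ)) * (p.1 : ℂ) = -(p.1 : ℂ) * Complex.I := by
      push_cast; ring
    simp only [cplx, fcos, eC, Pi.add_apply, Pi.smul_apply, smul_eq_mul, pow_zero, one_mul,
      h1, h2, Complex.ofReal_cos]
    rw [Complex.cos]
    ring
  rw [h]
  exact add_mem
    (Submodule.smul_mem _ _ (mem_W_of_mem_WGens (Or.inl (by simp [WGens]))))
    (Submodule.smul_mem _ _ (mem_W_of_mem_WGens (Or.inl (by simp [WGens]))))
end
noncomputable section
/-- `(ℓ² + 2αℓ) sin θ`. -/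
def fqs (α : ℝ) : ℝ × ℝ → ℝ := fun p => (p.2 ^ 2 + 2 * α * p.2) * Real.sin p.1
/-- `(ℓ² + 2αℓ) cos θ`. -/
def fqc (α : ℝ) : ℝ × ℝ → ℝ := fun p => (p.2 ^ 2 + 2 * α * p.2) * Real.cos p.1


set_option linter.unusedSimpArgs false

theorem alg_core {R : Type*} [Ring R] [Algebra ℂ R] (E F L A B : R)
    (h1 : E * F = 1) (h2 : F * E = 1) (h3 : L * E = E * L + E) (h4 : L * F = F * L - F)
    (h5 : L * A = A * L + A) (h6 : L * B = B * L - B)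
    (h7 : A * F = F * A - 2 * L) (h8 : B * E = E * B + 2 * L)
    (Y : R) (hY : (4:ℂ) • Y = B * A - A * B)
    (h9 : Y * E = E * Y + 3 * A) (h10 : Y * F = F * Y - 3 * B) :
    A = E * (L * L + L + (1/2:ℂ) • 1) ∧ B = F * (L * L - L + (1/2:ℂ) • 1) := by
  obtain ⟨K, hK⟩ : ∃ K, K = F * A - L * L - L := ⟨_, rfl⟩
  obtain ⟨M, hM⟩ : ∃ M, M = E * B - L * L + L := ⟨_, rfl⟩
  have hA : A = E * (L * L + L + K) := by
    rw [hK]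
    linear_combination (norm := noncomm_ring) -h1 * A
  have hB : B = F * (L * L - L + M) := by
    rw [hM]
    linear_combination (norm := noncomm_ring) -h2 * B
  have KF : K * F = F * K := by
    rw [hK]
    linear_combination (norm := noncomm_ring) F * h7 - L * h4 - h4 * L + h4 - h4
  have ME : M * E = E * M := by
    rw [hM]
    linear_combination (norm := noncomm_ring) E * h8 - L * h3 - h3 * L + h3 - h3
  have KE : K * E = E * K := by
    linear_combination (norm := noncomm_ring) -E * KF * E + E * K * h2 - h1 * K * E
  have MF : M * F = F * M := by
    linear_combination (norm := noncomm_ring) -F * ME * F + F * M * h1 - h2 * M * F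
  have KL : L * K = K * L := by
    rw [hK]
    linear_combination (norm := noncomm_ring) h4 * A + F * h5
  have ML : L * M = M * L := by
    rw [hM]
    linear_combination (norm := noncomm_ring) h3 * B + E * h6
  have hAB : A * B = (L * L - L + K) * (L * L - L + M) := by
    have : E * (L * L + L + K) * F = L * L - L + K := by
      linear_combination (norm := noncomm_ring) E * L * h4 + E * h4 * L + E * KF + h1 * L * L - h1 * L + h1 * K
    rw [← this]; nth_rw 1 [hA]; nth_rw 1 [hB]; noncomm_ring
  have hBA : B * A = (L * L + L + M) * (L * L + L + K) := by
    have : F * (L * L - L + M) * E = L * L + L + M := by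
      linear_combination (norm := noncomm_ring) F * L * h3 + F * h3 * L + F * ME + h2 * L * L + h2 * L + h2 * M
    rw [← this]; nth_rw 1 [hA]; nth_rw 1 [hB]; noncomm_ring
  have hY' : (4:ℂ) • Y = 4 * (L * L * L) + 2 * (L * (K + M)) + (M * K - K * M) := by
    rw [hY, hAB, hBA]
    linear_combination (norm := noncomm_ring) L * KL + KL * L - L * ML - ML * L - KL - ML
  have h9' : ((4:ℂ) • Y) * E = E * ((4:ℂ) • Y) + 12 * A := by
    rw [smul_mul_assoc, h9, mul_smul_comm, smul_add]
    congr 1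
    rw [show (4:ℂ) • (3 * A) = (4:ℕ) • (3 * A) by norm_cast]
    noncomm_ring
  have h10' : ((4:ℂ) • Y) * F = F * ((4:ℂ) • Y) - 12 * B := by
    rw [smul_mul_assoc, h10, mul_smul_comm, smul_sub]
    congr 1
    rw [show (4:ℂ) • (3 * B) = (4:ℕ) • (3 * B) by norm_cast]
    noncomm_ring
  rw [hY'] at h9' h10'
  have E2 : L * L * E = E * (L * L + 2 * L + 1) := by
    linear_combination (norm := noncomm_ring) L * h3 + h3 * L + h3
  have E3 : L * L * L * E = E * (L * L * L + 3 * L * L + 3 * L + 1) := by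
    linear_combination (norm := noncomm_ring) L * E2 + h3 * (L * L + 2 * L + 1)
  have F2 : L * L * F = F * (L * L - 2 * L + 1) := by
    linear_combination (norm := noncomm_ring) L * h4 + h4 * L - h4
  have F3 : L * L * L * F = F * (L * L * L - 3 * L * L + 3 * L - 1) := by
    linear_combination (norm := noncomm_ring) L * F2 + h4 * (L * L - 2 * L + 1)
  have e1 : 10 * K = 4 * 1 + 2 * M := by
    have q : E * (10 * K) = E * (4 * 1 + 2 * M) := by
      rw [hA] at h9'
      linear_combination (norm := noncomm_ring) 4 * E3 - h9' + 2 * h3 * (K + M) + 2 * L * KE + 2 * L * ME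
        + ME * K + M * KE - KE * M - K * ME
    linear_combination (norm := noncomm_ring) F * q - h2 * (10 * K) + h2 * (4 * 1 + 2 * M)
  have e2 : 10 * M = 4 * 1 + 2 * K := by
    have q : F * (10 * M) = F * (4 * 1 + 2 * K) := by
      rw [hB] at h10'
      linear_combination (norm := noncomm_ring) -4 * F3 + h10' - 2 * h4 * (K + M) - 2 * L * KF - 2 * L * MF
        - MF * K - M * KF + KF * M + K * MF
    linear_combination (norm := noncomm_ring) E * q - h1 * (10 * M) + h1 * (4 * 1 + 2 * K)
  have half : ∀ X : R, (96:ℕ) • X = (48:ℕ) • (1:R) → X = (1/2:ℂ) • 1 := by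
    intro X h
    have h' : (96:ℂ) • X = (48:ℂ) • (1:R) := by exact_mod_cast h
    have : X = (1/96:ℂ) • ((96:ℂ) • X) := by rw [smul_smul]; norm_num
    rw [this, h', smul_smul]; norm_num
  have hK2 : K = (1/2:ℂ) • 1 := half K (by
    linear_combination (norm := noncomm_ring) 10 * e1 + 2 * e2)
  have hM2 : M = (1/2:ℂ) • 1 := half M (by
    linear_combination (norm := noncomm_ring) 10 * e2 + 2 * e1)
  rw [← hK2]
  refine ⟨hA, ?_⟩
  rw [hK2, ← hM2]; exact hB

open Complex in
theorem alg_real {R : Type*} [Ring R] [Algebra ℂ R] (S C L A B W : R) (α : ℂ)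
    (hSC : S * C = C * S) (h1 : C * C + S * S = 1)
    (hLS : C = I • (L * S - S * L)) (hLC : -S = I • (L * C - C * L))
    (hLA : B = I • (L * A - A * L)) (hLB : -A = I • (L * B - B * L))
    (p1 : I • (S * A - A * S) + I • (C * B - B * C) = 0)
    (p2 : I • (C * A - A * C) - I • (S * B - B * S) = (2:ℂ) • (L + α • 1))
    (hW : W = I • (A * B - B * A))
    (w1 : -((6:ℂ) • B + (4 * α ^ 2) • C) = I • (W * S - S * W))
    (w2 : (6:ℂ) • A + (4 * α ^ 2) • S = I • (W * C - C * W)) :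
    A = S * (L * L) + ((2 * α) • S - I • C) * L + (1 / 2 : ℂ) • S - (I * α) • C ∧
    B = C * (L * L) + ((2 * α) • C + I • S) * L + (1 / 2 : ℂ) • C + (I * α) • S := by
  have two : ∀ X : R, 2 * X = (2:ℂ) • X := fun X => by rw [two_smul, two_mul]
  have three : ∀ X : R, 3 * X = (3:ℂ) • X := fun X => by
    rw [show (3:ℂ) = 2 + 1 by norm_num, add_smul, two_smul, one_smul,
      show (3:R) = 1 + 1 + 1 by norm_num, add_mul, add_mul, one_mul]
  have key := alg_core (C + I • S) (C - I • S) (L + α • 1) (B + I • A + (α ^ 2) • (C + I • S))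
    (B - I • A + (α ^ 2) • (C - I • S)) ?_ ?_ ?_ ?_ ?_ ?_ ?_ ?_
    (-(1/2:ℂ) • W + (α ^ 2) • (L + α • 1)) ?_ ?_ ?_
  · obtain ⟨k1, k2⟩ := key
    constructor
    · linear_combination (norm := skip) (-I / 2) • k1 + (I / 2) • k2
      simp only [two, three, mul_add, add_mul, mul_sub, sub_mul, smul_mul_assoc, mul_smul_comm,
        mul_one, one_mul, smul_add, smul_sub, smul_smul, mul_assoc]
      match_scalars <;> (try field_simp) <;> ring_nf <;> simp only [I_sq, show I ^ 3 = -I by rw [pow_succ, I_sq]; ring] <;> ring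
    · linear_combination (norm := skip) (1 / 2 : ℂ) • k1 + (1 / 2 : ℂ) • k2
      simp only [two, three, mul_add, add_mul, mul_sub, sub_mul, smul_mul_assoc, mul_smul_comm,
        mul_one, one_mul, smul_add, smul_sub, smul_smul, mul_assoc]
      match_scalars <;> (try field_simp) <;> ring_nf <;> simp only [I_sq, show I ^ 3 = -I by rw [pow_succ, I_sq]; ring] <;> ring
  · linear_combination (norm := skip) h1 + I • hSC
    simp only [two, three, mul_add, add_mul, mul_sub, sub_mul, smul_mul_assoc, mul_smul_comm,
      mul_one, one_mul, smul_add, smul_sub, smul_smul, mul_assoc]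
    match_scalars <;> (try field_simp) <;> ring_nf <;> simp only [I_sq, show I ^ 3 = -I by rw [pow_succ, I_sq]; ring] <;> ring
  · linear_combination (norm := skip) h1 - I • hSC
    simp only [two, three, mul_add, add_mul, mul_sub, sub_mul, smul_mul_assoc, mul_smul_comm,
      mul_one, one_mul, smul_add, smul_sub, smul_smul, mul_assoc]
    match_scalars <;> (try field_simp) <;> ring_nf <;> simp only [I_sq, show I ^ 3 = -I by rw [pow_succ, I_sq]; ring] <;> ring
  · linear_combination (norm := skip) I • hLC - hLS
    simp only [two, three, mul_add, add_mul, mul_sub, sub_mul, smul_mul_assoc, mul_smul_comm,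
      mul_one, one_mul, smul_add, smul_sub, smul_smul, mul_assoc]
    match_scalars <;> (try field_simp) <;> ring_nf <;> simp only [I_sq, show I ^ 3 = -I by rw [pow_succ, I_sq]; ring] <;> ring
  · linear_combination (norm := skip) I • hLC + hLS
    simp only [two, three, mul_add, add_mul, mul_sub, sub_mul, smul_mul_assoc, mul_smul_comm,
      mul_one, one_mul, smul_add, smul_sub, smul_smul, mul_assoc]
    match_scalars <;> (try field_simp) <;> ring_nf <;> simp only [I_sq, show I ^ 3 = -I by rw [pow_succ, I_sq]; ring] <;> ring
  · linear_combination (norm := skip) I • hLB - hLA + (α^2) • (I • hLC - hLS)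
    simp only [two, three, mul_add, add_mul, mul_sub, sub_mul, smul_mul_assoc, mul_smul_comm,
      mul_one, one_mul, smul_add, smul_sub, smul_smul, mul_assoc]
    match_scalars <;> (try field_simp) <;> ring_nf <;> simp only [I_sq, show I ^ 3 = -I by rw [pow_succ, I_sq]; ring] <;> ring
  · linear_combination (norm := skip) I • hLB + hLA + (α^2) • (I • hLC + hLS)
    simp only [two, three, mul_add, add_mul, mul_sub, sub_mul, smul_mul_assoc, mul_smul_comm,
      mul_one, one_mul, smul_add, smul_sub, smul_smul, mul_assoc]
    match_scalars <;> (try field_simp) <;> ring_nf <;> simp only [I_sq, show I ^ 3 = -I by rw [pow_succ, I_sq]; ring] <;> ring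
  · linear_combination (norm := skip) I • p1 - p2 + (2 * α^2 * I) • hSC
    simp only [two, three, mul_add, add_mul, mul_sub, sub_mul, smul_mul_assoc, mul_smul_comm,
      mul_one, one_mul, smul_add, smul_sub, smul_smul, mul_assoc]
    match_scalars <;> (try field_simp) <;> ring_nf <;> simp only [I_sq, show I ^ 3 = -I by rw [pow_succ, I_sq]; ring] <;> ring
  · linear_combination (norm := skip) I • p1 + p2 - (2 * α^2 * I) • hSC
    simp only [two, three, mul_add, add_mul, mul_sub, sub_mul, smul_mul_assoc, mul_smul_comm,
      mul_one, one_mul, smul_add, smul_sub, smul_smul, mul_assoc]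
    match_scalars <;> (try field_simp) <;> ring_nf <;> simp only [I_sq, show I ^ 3 = -I by rw [pow_succ, I_sq]; ring] <;> ring
  · linear_combination (norm := skip) (-2:ℂ) • hW - (2 * α^2) • p2 + (2 * α^4 * I) • hSC
    simp only [two, three, mul_add, add_mul, mul_sub, sub_mul, smul_mul_assoc, mul_smul_comm,
      mul_one, one_mul, smul_add, smul_sub, smul_smul, mul_assoc]
    match_scalars <;> (try field_simp) <;> ring_nf <;> simp only [I_sq, show I ^ 3 = -I by rw [pow_succ, I_sq]; ring] <;> ring
  · linear_combination (norm := skip) (1/2:ℂ) • w1 - (I/2) • w2 + (α^2) • (I • hLC - hLS)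
    simp only [two, three, mul_add, add_mul, mul_sub, sub_mul, smul_mul_assoc, mul_smul_comm,
      mul_one, one_mul, smul_add, smul_sub, smul_smul, mul_assoc]
    match_scalars <;> (try field_simp) <;> ring_nf <;> simp only [I_sq, show I ^ 3 = -I by rw [pow_succ, I_sq]; ring] <;> ring
  · linear_combination (norm := skip) (-1/2:ℂ) • w1 - (I/2) • w2 + (α^2) • (I • hLC + hLS)
    simp only [two, three, mul_add, add_mul, mul_sub, sub_mul, smul_mul_assoc, mul_smul_comm,
      mul_one, one_mul, smul_add, smul_sub, smul_smul, mul_assoc]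
    match_scalars <;> (try field_simp) <;> ring_nf <;> simp only [I_sq, show I ^ 3 = -I by rw [pow_succ, I_sq]; ring] <;> ring

lemma W_lie {α : ℝ} {f g : ℝ × ℝ → ℂ} (hf : f ∈ W α) (hg : g ∈ W α) : pbC f g ∈ W α := by
  rw [W, Submodule.mem_sInf] at *
  exact fun S hS => hS.2.2 f g (hf S hS) (hg S hS)

lemma pdTheta_cplx {f : ℝ × ℝ → ℝ} (hf : Differentiable ℝ f) (p : ℝ × ℝ) :
    pdThetaC (cplx f) p = (pdTheta f p : ℂ) := by
  have h : DifferentiableAt ℝ (fun t => f (t, p.2)) p.1 := by fun_prop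
  exact h.hasDerivAt.ofReal_comp.deriv

lemma pdEll_cplx {f : ℝ × ℝ → ℝ} (hf : Differentiable ℝ f) (p : ℝ × ℝ) :
    pdEllC (cplx f) p = (pdEll f p : ℂ) := by
  have h : DifferentiableAt ℝ (fun t => f (p.1, t)) p.2 := by fun_prop
  exact h.hasDerivAt.ofReal_comp.deriv

lemma pb_mem_V {α : ℝ} {f g : ℝ × ℝ → ℝ} (df : Differentiable ℝ f) (dg : Differentiable ℝ g)
    (hf : f ∈ V α) (hg : g ∈ V α) : pb f g ∈ V α := by
  have h : cplx (pb f g) = pbC (cplx f) (cplx g) := by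
    funext p
    simp [pbC, pdTheta_cplx, pdEll_cplx, df, dg, cplx, pb]
  show cplx (pb f g) ∈ W α
  rw [h]
  exact W_lie hf hg

lemma gen_mem (α : ℝ) (N : ℤ) :
    eC 2 (2 * N + 1) + (2 * α : ℂ) • eC 1 (2 * N + 1) ∈ W α :=
  mem_W_of_mem_WGens (Or.inr ⟨N, rfl⟩)

lemma fqs_mem (α : ℝ) : fqs α ∈ V α := by
  show cplx (fqs α) ∈ W α
  have h : cplx (fqs α) = (Complex.I / 2) • (eC 2 (2 * (-1) + 1) + (2 * α : ℂ) • eC 1 (2 * (-1) + 1))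
      - (Complex.I / 2) • (eC 2 (2 * 0 + 1) + (2 * α : ℂ) • eC 1 (2 * 0 + 1)) := by
    funext p
    have h1 : Complex.I * (((2 * 0 + 1 : ℤ) : ℂ)) * (p.1 : ℂ) = (p.1 : ℂ) * Complex.I := by
      push_cast; ring
    have h2 : Complex.I * (((2 * (-1) + 1 : ℤ) : ℂ)) * (p.1 : ℂ) = -(p.1 : ℂ) * Complex.I := by
      push_cast; ring
    simp only [cplx, fqs, eC, Pi.sub_apply, Pi.add_apply, Pi.smul_apply, smul_eq_mul,
      h1, h2, Complex.ofReal_sin, Complex.ofReal_mul, Complex.ofReal_add, Complex.ofReal_pow]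
    rw [Complex.sin]
    push_cast
    ring
  rw [h]
  exact sub_mem (Submodule.smul_mem _ _ (gen_mem α _)) (Submodule.smul_mem _ _ (gen_mem α _))

lemma fqc_mem (α : ℝ) : fqc α ∈ V α := by
  show cplx (fqc α) ∈ W α
  have h : cplx (fqc α) = (1 / 2 : ℂ) • (eC 2 (2 * (-1) + 1) + (2 * α : ℂ) • eC 1 (2 * (-1) + 1))
      + (1 / 2 : ℂ) • (eC 2 (2 * 0 + 1) + (2 * α : ℂ) • eC 1 (2 * 0 + 1)) := by
    funext p
    have h1 : Complex.I * (((2 * 0 + 1 : ℤ) : ℂ)) * (p.1 : ℂ) = (p.1 : ℂ) * Complex.I := by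
      push_cast; ring
    have h2 : Complex.I * (((2 * (-1) + 1 : ℤ) : ℂ)) * (p.1 : ℂ) = -(p.1 : ℂ) * Complex.I := by
      push_cast; ring
    simp only [cplx, fqc, eC, Pi.add_apply, Pi.smul_apply, smul_eq_mul,
      h1, h2, Complex.ofReal_cos, Complex.ofReal_mul, Complex.ofReal_add, Complex.ofReal_pow]
    rw [Complex.cos]
    push_cast
    ring
  rw [h]
  exact add_mem (Submodule.smul_mem _ _ (gen_mem α _)) (Submodule.smul_mem _ _ (gen_mem α _))

lemma d_ell : Differentiable ℝ fell := by unfold fell; fun_prop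
lemma d_sin : Differentiable ℝ fsin := by unfold fsin; fun_prop
lemma d_cos : Differentiable ℝ fcos := by unfold fcos; fun_prop
lemma d_qs (α : ℝ) : Differentiable ℝ (fqs α) := by unfold fqs; fun_prop
lemma d_qc (α : ℝ) : Differentiable ℝ (fqc α) := by unfold fqc; fun_prop

lemma T_ell (p) : pdTheta fell p = 0 := by simp [pdTheta, fell]
lemma L_ell (p) : pdEll fell p = 1 := by simp [pdEll, fell]
lemma T_sin (p) : pdTheta fsin p = Real.cos p.1 := by simp [pdTheta, fsin]
lemma L_sin (p) : pdEll fsin p = 0 := by simp [pdEll, fsin]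
lemma T_cos (p) : pdTheta fcos p = -Real.sin p.1 := by simp [pdTheta, fcos]
lemma L_cos (p) : pdEll fcos p = 0 := by simp [pdEll, fcos]
lemma T_qs (α : ℝ) (p) : pdTheta (fqs α) p = (p.2 ^ 2 + 2 * α * p.2) * Real.cos p.1 := by
  simp [pdTheta, fqs]
lemma T_qc (α : ℝ) (p) : pdTheta (fqc α) p = -(p.2 ^ 2 + 2 * α * p.2) * Real.sin p.1 := by
  simp [pdTheta, fqc]
  ring
lemma hd_h (α x : ℝ) : HasDerivAt (fun l : ℝ => l ^ 2 + 2 * α * l) (2 * x + 2 * α) x := by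
  have h := (hasDerivAt_pow 2 x).fun_add ((hasDerivAt_id x).const_mul (2 * α))
  simp only [id] at h
  rw [show 2 * x + 2 * α = ((2 : ℕ) : ℝ) * x ^ (2 - 1) + 2 * α * 1 by norm_num]
  exact h
lemma L_qs (α : ℝ) (p) : pdEll (fqs α) p = (2 * p.2 + 2 * α) * Real.sin p.1 :=
  ((hd_h α p.2).mul_const (Real.sin p.1)).deriv
lemma L_qc (α : ℝ) (p) : pdEll (fqc α) p = (2 * p.2 + 2 * α) * Real.cos p.1 :=
  ((hd_h α p.2).mul_const (Real.cos p.1)).deriv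

def fw (α : ℝ) : ℝ × ℝ → ℝ := fun p => -((p.2 ^ 2 + 2 * α * p.2) * (2 * p.2 + 2 * α))

lemma fw_eq (α : ℝ) : pb (fqs α) (fqc α) = fw α := by
  funext p
  simp only [pb, T_qs, T_qc, L_qs, L_qc, fw]
  linear_combination -(p.2 ^ 2 + 2 * α * p.2) * (2 * p.2 + 2 * α) * Real.sin_sq_add_cos_sq p.1

lemma T_w (α : ℝ) (p) : pdTheta (fw α) p = 0 := by simp [pdTheta, fw]
lemma L_w (α : ℝ) (p) : pdEll (fw α) p =
    -(6 * (p.2 ^ 2 + 2 * α * p.2) + 4 * α ^ 2) := by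
  have h2 : HasDerivAt (fun l : ℝ => 2 * l + 2 * α) 2 p.2 := by
    simpa using ((hasDerivAt_id p.2).const_mul 2).add_const (2 * α)
  refine (((hd_h α p.2).mul h2).neg).deriv.trans ?_
  ring

lemma fw_mem (α : ℝ) : fw α ∈ V α :=
  fw_eq α ▸ pb_mem_V (d_qs α) (d_qc α) (fqs_mem α) (fqc_mem α)

lemma Q_br {α ν : ℝ} {Q : V α →ₗ[ℝ] (Dom →ₗ[ℂ] Dom)} (hQ : IsQuant (V α) ν Q)
    (f g k : V α) (h : pb f g = k) :
    Q k = Complex.I • ((Q f * Q g - Q g * Q f : Module.End ℂ Dom)) := by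
  have hm : pb f g ∈ V α := h ▸ k.2
  rw [show k = ⟨pb f g, hm⟩ from Subtype.ext h.symm, hQ.map_bracket]
  rfl

/-- Von Neumann rules on `V_α` for `(ℓ² + 2αℓ) sin θ` and `(ℓ² + 2αℓ) cos θ`. -/
theorem stmt14 (α ν : ℝ) (Q : V α →ₗ[ℝ] (Dom →ₗ[ℂ] Dom)) (hQ : IsQuant (V α) ν Q) :
    ∃ (hs : fqs α ∈ V α) (hc : fqc α ∈ V α),
      Q ⟨fqs α, hs⟩ =
        Q ⟨fsin, fsin_mem_V α⟩ ∘ₗ Q ⟨fell, fell_mem_V α⟩ ∘ₗ Q ⟨fell, fell_mem_V α⟩ +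
          (((2 * α : ℝ) : ℂ) • Q ⟨fsin, fsin_mem_V α⟩ -
            Complex.I • Q ⟨fcos, fcos_mem_V α⟩) ∘ₗ Q ⟨fell, fell_mem_V α⟩ +
          (1 / 2 : ℂ) • Q ⟨fsin, fsin_mem_V α⟩ -
          (Complex.I * (α : ℂ)) • Q ⟨fcos, fcos_mem_V α⟩ ∧
      Q ⟨fqc α, hc⟩ =
        Q ⟨fcos, fcos_mem_V α⟩ ∘ₗ Q ⟨fell, fell_mem_V α⟩ ∘ₗ Q ⟨fell, fell_mem_V α⟩ +
          (((2 * α : ℝ) : ℂ) • Q ⟨fcos, fcos_mem_V α⟩ +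
            Complex.I • Q ⟨fsin, fsin_mem_V α⟩) ∘ₗ Q ⟨fell, fell_mem_V α⟩ +
          (1 / 2 : ℂ) • Q ⟨fcos, fcos_mem_V α⟩ +
          (Complex.I * (α : ℂ)) • Q ⟨fsin, fsin_mem_V α⟩ := by
  refine ⟨fqs_mem α, fqc_mem α, ?_⟩
  set s : V α := ⟨fsin, fsin_mem_V α⟩ with hs
  set c : V α := ⟨fcos, fcos_mem_V α⟩ with hc
  set l : V α := ⟨fell, fell_mem_V α⟩ with hl
  set a : V α := ⟨fqs α, fqs_mem α⟩ with ha
  set b : V α := ⟨fqc α, fqc_mem α⟩ with hb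
  set w : V α := ⟨fw α, fw_mem α⟩ with hw
  set o : V α := ⟨fone, fone_mem_V α⟩ with ho
  have rs : ∀ (r : ℝ) (X : Module.End ℂ Dom), r • X = (r : ℂ) • X := fun r X => rfl
  have key := alg_real (R := Module.End ℂ Dom) (Q s) (Q c) (Q l) (Q a) (Q b) (Q w) (α : ℂ)
    ?_ ?_ ?_ ?_ ?_ ?_ ?_ ?_ ?_ ?_ ?_
  · rw [show ((2 * α : ℝ) : ℂ) = 2 * (α : ℂ) by push_cast; rfl]
    exact key
  · ext ψ t
    simp only [Module.End.mul_apply, hs, hc, hQ.map_sin, hQ.map_cos]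
    ring
  · ext ψ t
    have e := Complex.sin_sq_add_cos_sq (t : ℂ)
    simp only [Module.End.mul_apply, LinearMap.add_apply, Submodule.coe_add, Pi.add_apply,
      hs, hc, hQ.map_sin, hQ.map_cos, Module.End.one_apply]
    push_cast
    linear_combination (ψ : ℝ → ℂ) t * e
  · exact Q_br hQ l s c (by funext p; simp [pb, hs, hc, hl, T_ell, L_ell, T_sin, L_sin, fcos])
  · rw [← map_neg]
    exact Q_br hQ l c (-s) (by funext p; simp [pb, hs, hc, hl, T_ell, L_ell, T_cos, L_cos, fsin])
  · exact Q_br hQ l a b (by funext p; simp [pb, ha, hb, hl, T_ell, L_ell, T_qs, L_qs, fqc])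
  · rw [← map_neg]
    exact Q_br hQ l b (-a) (by
      funext p; simp [pb, ha, hb, hl, T_ell, L_ell, T_qc, L_qc, fqs]; try ring)
  · have e : (⟨_, pb_mem_V d_sin (d_qs α) s.2 a.2⟩ : V α) + ⟨_, pb_mem_V d_cos (d_qc α) c.2 b.2⟩
        = 0 := by
      apply Subtype.ext
      funext p
      simp [pb, hs, ha, hc, hb, T_sin, L_sin, T_cos, L_cos, T_qs, T_qc, L_qs, L_qc]
      ring
    have q := congrArg Q e
    rw [map_add, map_zero, Q_br hQ s a ⟨_, pb_mem_V d_sin (d_qs α) s.2 a.2⟩ rfl,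
      Q_br hQ c b ⟨_, pb_mem_V d_cos (d_qc α) c.2 b.2⟩ rfl] at q
    exact q
  · have e : (⟨_, pb_mem_V d_cos (d_qs α) c.2 a.2⟩ : V α) - ⟨_, pb_mem_V d_sin (d_qc α) s.2 b.2⟩
        = (2:ℝ) • (l + α • o) := by
      apply Subtype.ext
      funext p
      have e := Real.sin_sq_add_cos_sq p.1
      simp [pb, hs, ha, hc, hb, T_sin, L_sin, T_cos, L_cos, T_qs, T_qc, L_qs, L_qc, hl, ho,
        fell, fone]
      linear_combination (2 * p.2 + 2 * α) * e
    have q := congrArg Q e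
    have h1 : Q o = (1 : Module.End ℂ Dom) := hQ.map_one _
    rw [map_sub, map_smul, map_add, map_smul, Q_br hQ c a ⟨_, pb_mem_V d_cos (d_qs α) c.2 a.2⟩ rfl,
      Q_br hQ s b ⟨_, pb_mem_V d_sin (d_qc α) s.2 b.2⟩ rfl, h1] at q
    have h2 : (2:ℂ) = ((2:ℝ):ℂ) := by norm_num
    refine Eq.trans q ?_
    rw [h2]
    exact rs _ _
  · exact Q_br hQ a b w (fw_eq α)
  · rw [← Q_br hQ w s (-((6:ℝ) • b + (4 * α ^ 2) • c))]
    · rw [map_neg, map_add, map_smul, map_smul, rs, rs]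
      push_cast
      rfl
    · funext p
      simp [pb, hw, hs, hb, hc, T_w, L_w, T_sin, L_sin, fqc, fcos]
      ring
  · rw [← Q_br hQ w c ((6:ℝ) • a + (4 * α ^ 2) • s)]
    · rw [map_add, map_smul, map_smul, rs, rs]
      push_cast
      rfl
    · funext p
      simp [pb, hw, hs, ha, hc, T_w, L_w, T_cos, L_cos, fqs, fsin]
      ring
end
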